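/- Let n ≥ 3 and let Q(X) = n·∏_{i=1}^{n−1}(X − b_i) with real numbers b₁ < b₂ < … < b_{n−1}, and set P(X) = ∫₀^X Q(t) dt. Then: (a) if P₀ is any real monic polynomial of degree n with n distinct real roots, its derivative P₀′ has n−1 distinct real roots; (b) there exists c ∈ ℝ such that the polynomial P(X) − c has n distinct real roots if and only if m(Q) < M(Q). -/

import Mathlib

open Polynomial

/-- A real polynomial of degree `N` with `N` distinct real roots is its leading coefficient times
the product of the corresponding linear factors. -/
theorem eq_C_mul_prod_X_sub_C {N : ℕ} {p : ℝ[X]} (hp : p.natDegree = N) {f : Fin N → ℝ}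
    (hf : Function.Injective f) (hroot : ∀ i, p.eval (f i) = 0) :
    p = C p.leadingCoeff * ∏ i, (X - C (f i)) := by
  rcases eq_or_ne p 0 with rfl | h0
  · simp
  have hle : Finset.univ.val.map f ≤ p.roots := by
    rw [Multiset.le_iff_subset (Finset.univ.nodup.map hf)]
    intro x hx
    obtain ⟨i, -, rfl⟩ := Multiset.mem_map.1 hx
    exact (mem_roots h0).2 (hroot i)
  have heq : Finset.univ.val.map f = p.roots :=
    Multiset.eq_of_le_of_card_le hle (by simpa [hp] using p.card_roots')
  have h := C_leadingCoeff_mul_prod_multiset_X_sub_C (p := p) (by rw [← heq]; simp [hp])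
  rw [← heq, Multiset.map_map] at h
  exact h.symm

theorem strictMono_of_interlacing {N : ℕ} {y : Fin (N + 1) → ℝ} {a : Fin N → ℝ}
    (hy : Monotone y) (h₁ : ∀ i : Fin N, y i.castSucc < a i) (h₂ : ∀ i : Fin N, a i < y i.succ) :
    StrictMono a := fun i j hij =>
  (h₂ i).trans ((hy (Fin.succ_le_castSucc_iff.2 hij)).trans_lt (h₁ j))

/-- Rolle's theorem for consecutive roots of a polynomial. -/
theorem exists_interlacing_derivative_roots {N : ℕ} {F : ℝ[X]} {a : Fin (N + 1) → ℝ}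
    (ha : StrictMono a) (hF : ∀ i, F.eval (a i) = 0) :
    ∃ β : Fin N → ℝ, (∀ i : Fin N, a i.castSucc < β i) ∧ (∀ i : Fin N, β i < a i.succ) ∧
      ∀ i, F.derivative.eval (β i) = 0 := by
  have h (i : Fin N) : ∃ x, a i.castSucc < x ∧ x < a i.succ ∧ F.derivative.eval x = 0 := by
    obtain ⟨x, hx, h⟩ := exists_hasDerivAt_eq_zero (ha i.castSucc_lt_succ) F.continuousOn
      ((hF _).trans (hF _).symm) fun x _ => F.hasDerivAt x
    exact ⟨x, hx.1, hx.2, h⟩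
  choose β h₁ h₂ h₃ using h
  exact ⟨β, h₁, h₂, h₃⟩

theorem neg_one_pow_mul_prod_sub_pos {N : ℕ} {a : Fin (N + 1) → ℝ} (ha : Monotone a)
    (k : Fin N) {x : ℝ} (h₁ : a k.castSucc < x) (h₂ : x < a k.succ) :
    0 < (-1) ^ (N - (k : ℕ)) * ∏ i, (x - a i) := by
  have h : (-1 : ℝ) ^ (N - (k : ℕ)) = ∏ i : Fin (N + 1), if k.castSucc < i then -1 else 1 := by
    rw [Finset.prod_ite, Finset.prod_const, Finset.prod_const_one, mul_one]
    congr 1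
    rw [Finset.filter_lt_eq_Ioi, Fin.card_Ioi]
    simp
  rw [h, ← Finset.prod_mul_distrib]
  refine Finset.prod_pos fun i _ => ?_
  split_ifs with hi
  · linarith [ha (Fin.castSucc_lt_iff_succ_le.1 hi)]
  · linarith [ha (not_lt.1 hi)]

/-- A nonconstant polynomial with positive leading coefficient is positive somewhere to the
right of any given point. -/
theorem exists_gt_eval_pos {F : ℝ[X]} (hF : 0 < F.degree) (hlc : 0 ≤ F.leadingCoeff) (B : ℝ) :
    ∃ x, B < x ∧ 0 < F.eval x :=
  ((Filter.eventually_gt_atTop B).and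
    ((F.tendsto_atTop_of_leadingCoeff_nonneg hF hlc).eventually_gt_atTop 0)).exists

theorem exists_lt_neg_one_pow_mul_eval_pos {F : ℝ[X]} (hF : 0 < F.degree) (hlc : 0 ≤ F.leadingCoeff)
    (B : ℝ) : ∃ x, x < B ∧ 0 < (-1) ^ F.natDegree * F.eval x := by
  have hdeg : (C ((-1) ^ F.natDegree) * F.comp (-X)).natDegree = F.natDegree := by
    rw [natDegree_C_mul (by simp), natDegree_comp, natDegree_neg, natDegree_X, mul_one]
  obtain ⟨x, hx, h⟩ := exists_gt_eval_pos (F := C ((-1) ^ F.natDegree) * F.comp (-X))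
    (natDegree_pos_iff_degree_pos.1 (hdeg ▸ natDegree_pos_iff_degree_pos.2 hF))
    (by
      rw [leadingCoeff_mul, leadingCoeff_C, leadingCoeff_comp (by simp), leadingCoeff_neg,
        leadingCoeff_X, mul_left_comm, ← mul_pow]
      simpa using hlc) (-B)
  exact ⟨-x, by linarith, by simpa using h⟩

theorem exists_root_of_mul_neg {F : ℝ[X]} {u v : ℝ} (huv : u ≤ v)
    (h : F.eval u * F.eval v < 0) : ∃ x, u < x ∧ x < v ∧ F.eval x = 0 := by
  rcases mul_neg_iff.1 h with ⟨h₁, h₂⟩ | ⟨h₁, h₂⟩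
  · obtain ⟨x, hx, h⟩ := intermediate_value_Ioo' huv F.continuousOn ⟨h₂, h₁⟩
    exact ⟨x, hx.1, hx.2, h⟩
  · obtain ⟨x, hx, h⟩ := intermediate_value_Ioo huv F.continuousOn ⟨h₁, h₂⟩
    exact ⟨x, hx.1, hx.2, h⟩

/-- Roots between consecutive sample points at which the signs alternate. -/
theorem exists_interlacing_roots {N : ℕ} {F : ℝ[X]} {y : Fin (N + 1) → ℝ} (hy : StrictMono y)
    (hF : ∀ j : Fin (N + 1), 0 < (-1) ^ (N - (j : ℕ)) * F.eval (y j)) :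
    ∃ a : Fin N → ℝ, StrictMono a ∧ ∀ i, F.eval (a i) = 0 := by
  have h (i : Fin N) : ∃ x, y i.castSucc < x ∧ x < y i.succ ∧ F.eval x = 0 := by
    refine exists_root_of_mul_neg (hy i.castSucc_lt_succ).le ?_
    have h₁ := hF i.castSucc
    have h₂ := hF i.succ
    have hi : N - (i : ℕ) = N - (i + 1) + 1 := by omega
    rw [Fin.val_castSucc, hi, pow_succ] at h₁
    rw [Fin.val_succ] at h₂
    rcases neg_one_pow_eq_or ℝ (N - ((i : ℕ) + 1)) with h | h <;> rw [h] at h₁ h₂ <;> nlinarith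
  choose a h₁ h₂ h₃ using h
  exact ⟨a, strictMono_of_interlacing hy.monotone h₁ h₂, h₃⟩

theorem strictMono_fin_cons {N : ℕ} {f : Fin N → ℝ} (hf : StrictMono f) {x : ℝ}
    (hx : ∀ i, x < f i) : StrictMono (Fin.cons x f : Fin (N + 1) → ℝ) := by
  intro i j hij
  cases j using Fin.cases with
  | zero => exact absurd hij (Fin.not_lt_zero i)
  | succ j =>
    cases i using Fin.cases with
    | zero => simpa using hx j
    | succ i => simpa using hf (Fin.succ_lt_succ_iff.1 hij)

theorem strictMono_fin_snoc {N : ℕ} {f : Fin N → ℝ} (hf : StrictMono f) {x : ℝ}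
    (hx : ∀ i, f i < x) : StrictMono (Fin.snoc f x : Fin (N + 1) → ℝ) := by
  intro i j hij
  cases i using Fin.lastCases with
  | last => exact absurd hij (Fin.le_last j).not_gt
  | cast i =>
    cases j using Fin.lastCases with
    | last => simpa using hx i
    | cast j => simpa using hf (Fin.castSucc_lt_castSucc_iff.1 hij)

theorem exists_strictMono_prod_X_sub_C_eq {N : ℕ} {a : Fin N → ℝ} (ha : Function.Injective a) :
    ∃ a' : Fin N → ℝ, StrictMono a' ∧ ∏ i, (X - C (a' i)) = ∏ i, (X - C (a i)) :=
  ⟨a ∘ Tuple.sort a, (Tuple.monotone_sort a).strictMono_of_injective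
    (ha.comp (Tuple.sort a).injective), Equiv.prod_comp (Tuple.sort a) fun i => X - C (a i)⟩

theorem eval_prod_X_sub_C_eq_zero {N : ℕ} (a : Fin N → ℝ) (i : Fin N) :
    (∏ j, (X - C (a j))).eval (a i) = 0 := by
  rw [eval_prod]
  exact Finset.prod_eq_zero (Finset.mem_univ i) (by simp)

theorem natDegree_prod_X_sub_C_fin {N : ℕ} (a : Fin N → ℝ) :
    (∏ j, (X - C (a j))).natDegree = N := by
  simp

/-- The derivative of a monic real polynomial with distinct real roots has distinct real roots. -/
theorem exists_derivative_eq_prod {N : ℕ} {a : Fin (N + 1) → ℝ} (ha : Function.Injective a) :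
    ∃ β : Fin N → ℝ, Function.Injective β ∧
      (∏ i, (X - C (a i))).derivative = C ((N + 1 : ℕ) : ℝ) * ∏ i, (X - C (β i)) := by
  obtain ⟨a', ha', heq⟩ := exists_strictMono_prod_X_sub_C_eq ha
  rw [← heq]
  obtain ⟨β, h₁, h₂, h₃⟩ := exists_interlacing_derivative_roots ha' (eval_prod_X_sub_C_eq_zero a')
  have hβ := (strictMono_of_interlacing ha'.monotone h₁ h₂).injective
  have hdeg : (∏ i, (X - C (a' i))).derivative.natDegree = N := by
    rw [natDegree_derivative, natDegree_prod_X_sub_C_fin, Nat.add_sub_cancel]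
  refine ⟨β, hβ, (eq_C_mul_prod_X_sub_C hdeg hβ h₃).trans ?_⟩
  congr 2
  have hc : (∏ i, (X - C (a' i))).coeff (N + 1) = 1 := by
    have := (monic_prod_X_sub_C a' Finset.univ).coeff_natDegree
    rwa [natDegree_prod_X_sub_C_fin] at this
  rw [leadingCoeff, hdeg, coeff_derivative, hc]
  push_cast
  ring

/-- At the critical points of a monic polynomial with distinct real roots the signs alternate. -/
theorem neg_one_pow_mul_eval_pos_of_eq_prod {N : ℕ} {b : Fin N → ℝ} (hb : StrictMono b) {F : ℝ[X]}
    {r : ℝ} (hr : r ≠ 0) (hF' : F.derivative = C r * ∏ i, (X - C (b i)))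
    {a : Fin (N + 1) → ℝ} (ha : Function.Injective a) (hF : F = ∏ i, (X - C (a i))) (k : Fin N) :
    0 < (-1) ^ (N - (k : ℕ)) * F.eval (b k) := by
  obtain ⟨a', ha', heq⟩ := exists_strictMono_prod_X_sub_C_eq ha
  rw [← heq] at hF
  obtain ⟨β, h₁, h₂, h₃⟩ := exists_interlacing_derivative_roots (F := F) ha'
    (hF ▸ eval_prod_X_sub_C_eq_zero a')
  have hβ := strictMono_of_interlacing ha'.monotone h₁ h₂
  have hmem (i : Fin N) : ∃ j, b j = β i := by
    have h := h₃ i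
    rw [hF', eval_mul, eval_C, eval_prod, mul_eq_zero, or_iff_right hr,
      Finset.prod_eq_zero_iff] at h
    obtain ⟨j, -, hj⟩ := h
    exact ⟨j, by simpa [sub_eq_zero, eq_comm] using hj⟩
  choose σ hσ using hmem
  have hσm : StrictMono σ := fun i j hij => hb.lt_iff_lt.1 (by rw [hσ, hσ]; exact hβ hij)
  have hσk : σ k = k := by
    have : σ = id := (hσm.range_inj strictMono_id).1
      (by rw [(Finite.injective_iff_surjective.1 hσm.injective).range_eq, Set.range_id])
    rw [this, id]
  have hbk : b k = β k := by rw [← hσ k, hσk]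
  rw [hbk, hF, eval_prod]
  simpa using neg_one_pow_mul_prod_sub_pos ha'.monotone k (h₁ k) (h₂ k)

/-- A monic polynomial whose signs alternate at its critical points has distinct real roots. -/
theorem exists_eq_prod_of_neg_one_pow_mul_eval_pos {N : ℕ} {b : Fin N → ℝ}
    (hb : StrictMono b) {F : ℝ[X]} (hmonic : F.Monic) (hdeg : F.natDegree = N + 1)
    (hsign : ∀ k : Fin N, 0 < (-1) ^ (N - (k : ℕ)) * F.eval (b k)) :
    ∃ a : Fin (N + 1) → ℝ, Function.Injective a ∧ F = ∏ i, (X - C (a i)) := by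
  have hpos : 0 < F.degree := natDegree_pos_iff_degree_pos.1 (by omega)
  have hlc : 0 ≤ F.leadingCoeff := by rw [hmonic.leadingCoeff]; exact zero_le_one
  obtain ⟨B, hB⟩ := (Set.finite_range b).bddAbove
  obtain ⟨v, hv, hFv⟩ := exists_gt_eval_pos hpos hlc B
  have hs : StrictMono (Fin.snoc b v : Fin (N + 1) → ℝ) :=
    strictMono_fin_snoc hb fun i => (hB ⟨i, rfl⟩).trans_lt hv
  obtain ⟨u, hu, hFu⟩ := exists_lt_neg_one_pow_mul_eval_pos hpos hlc
    ((Fin.snoc b v : Fin (N + 1) → ℝ) 0)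
  have hc := strictMono_fin_cons hs fun i => hu.trans_le (hs.monotone (Fin.zero_le i))
  obtain ⟨a, ha, hroot⟩ := exists_interlacing_roots (F := F) hc (by
    intro j
    cases j using Fin.cases with
    | zero => simpa [hdeg] using hFu
    | succ j =>
      cases j using Fin.lastCases with
      | last => simpa using hFv
      | cast j => simpa using hsign j)
  refine ⟨a, ha.injective, ?_⟩
  simpa [hmonic.leadingCoeff] using eq_C_mul_prod_X_sub_C hdeg ha.injective hroot

theorem monic_and_natDegree_of_derivative_eq {N : ℕ} (hN : N ≠ 0) {b : Fin N → ℝ} {F : ℝ[X]}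
    (hF : F.derivative = C ((N + 1 : ℕ) : ℝ) * ∏ i, (X - C (b i))) :
    F.Monic ∧ F.natDegree = N + 1 := by
  have hdeg : F.natDegree = N + 1 := by
    have h := congrArg natDegree hF
    rw [natDegree_derivative, natDegree_C_mul (by positivity), natDegree_prod_X_sub_C_fin] at h
    omega
  refine ⟨?_, hdeg⟩
  have hc : (∏ i, (X - C (b i))).coeff N = 1 := by
    have := (monic_prod_X_sub_C b Finset.univ).coeff_natDegree
    rwa [natDegree_prod_X_sub_C_fin] at this
  have h := congrArg (fun p => coeff p N) hF
  simp only [coeff_derivative, coeff_C_mul, hc, mul_one, Nat.cast_add, Nat.cast_one] at h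
  rw [Monic, leadingCoeff, hdeg]
  exact mul_right_cancel₀ (by positivity : (N : ℝ) + 1 ≠ 0) (h.trans (one_mul _).symm)

/-- Some translate `P - c` has only simple real roots iff every local minimum value of `P` lies
below every local maximum value. -/
theorem exists_sub_C_eq_prod_iff {N : ℕ} (hN : N ≠ 0) {b : Fin N → ℝ} (hb : StrictMono b)
    {P : ℝ[X]} (hP : P.derivative = C ((N + 1 : ℕ) : ℝ) * ∏ i, (X - C (b i))) {m M : ℝ}
    (hm : IsGreatest {y | ∃ k : Fin N, ((k : ℕ) + 1) % 2 = N % 2 ∧ y = P.eval (b k)} m)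
    (hM : IsLeast {y | ∃ k : Fin N, ((k : ℕ) + 1) % 2 = (N + 1) % 2 ∧ y = P.eval (b k)} M) :
    (∃ (c : ℝ) (a : Fin (N + 1) → ℝ), Function.Injective a ∧ P - C c = ∏ i, (X - C (a i))) ↔
      m < M := by
  have hodd (k : Fin N) (h : ((k : ℕ) + 1) % 2 = N % 2) : Odd (N - (k : ℕ)) := by
    rw [Nat.odd_iff]; omega
  have heven (k : Fin N) (h : ((k : ℕ) + 1) % 2 = (N + 1) % 2) : Even (N - (k : ℕ)) := by
    rw [Nat.even_iff]; omega
  have hP' (c : ℝ) : (P - C c).derivative = C ((N + 1 : ℕ) : ℝ) * ∏ i, (X - C (b i)) := by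
    rw [derivative_sub, derivative_C, sub_zero, hP]
  constructor
  · rintro ⟨c, a, ha, h⟩
    have hsign := neg_one_pow_mul_eval_pos_of_eq_prod hb (by positivity) (hP' c) ha h
    obtain ⟨k, hk, rfl⟩ := hm.1
    obtain ⟨l, hl, rfl⟩ := hM.1
    have h₁ := hsign k
    have h₂ := hsign l
    rw [(hodd k hk).neg_one_pow, eval_sub, eval_C] at h₁
    rw [(heven l hl).neg_one_pow, eval_sub, eval_C] at h₂
    linarith
  · intro hlt
    obtain ⟨c, hmc, hcM⟩ := exists_between hlt
    obtain ⟨hmonic, hdeg⟩ := monic_and_natDegree_of_derivative_eq hN (hP' c)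
    refine ⟨c, exists_eq_prod_of_neg_one_pow_mul_eval_pos hb hmonic hdeg fun k => ?_⟩
    rw [eval_sub, eval_C]
    by_cases hk : ((k : ℕ) + 1) % 2 = N % 2
    · rw [(hodd k hk).neg_one_pow]
      linarith [hm.2 ⟨k, hk, rfl⟩]
    · have hk' : ((k : ℕ) + 1) % 2 = (N + 1) % 2 := by omega
      rw [(heven k hk').neg_one_pow]
      linarith [hM.2 ⟨k, hk', rfl⟩]

/-- let `n ≥ 3`, `Q(X) = n·∏(X − bᵢ)` with `b₁ < … < b_{n−1}`
real, `P` the primitive of `Q` vanishing at `0`, and let `m = m(Q)` (the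
maximum of `P(b_k)` over `k ≡ n−1 (mod 2)`) and `M = M(Q)` (the minimum of
`P(b_k)` over `k ≡ n (mod 2)`), with `k` the 1-based index.  Then:
(a) the derivative of any real monic polynomial of degree `n` with `n`
distinct real roots has `n−1` distinct real roots;
(b) there is `c ∈ ℝ` such that `P − c` has `n` distinct real roots iff
`m(Q) < M(Q)`. -/
theorem stmt_18 (n : ℕ) (hn : 3 ≤ n) (b : Fin (n - 1) → ℝ) (hb : StrictMono b)
    (Q P : Polynomial ℝ)
    (hQ : Q = C (n : ℝ) * ∏ i, (X - C (b i)))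
    (hP : P.derivative = Q) (hP0 : P.eval 0 = 0)
    (m M : ℝ)
    (hm : IsGreatest
      {y | ∃ k : Fin (n - 1), ((k : ℕ) + 1) % 2 = (n - 1) % 2 ∧ y = P.eval (b k)} m)
    (hM : IsLeast
      {y | ∃ k : Fin (n - 1), ((k : ℕ) + 1) % 2 = n % 2 ∧ y = P.eval (b k)} M) :
    (∀ (P₀ : Polynomial ℝ) (a : Fin n → ℝ), Function.Injective a →
        P₀ = ∏ i, (X - C (a i)) →
        ∃ β : Fin (n - 1) → ℝ, Function.Injective β ∧
          P₀.derivative = C (n : ℝ) * ∏ i, (X - C (β i))) ∧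
    ((∃ (c : ℝ) (a : Fin n → ℝ), Function.Injective a ∧ P - C c = ∏ i, (X - C (a i)))
      ↔ m < M) := by
  obtain ⟨N, rfl⟩ : ∃ N, n = N + 1 := ⟨n - 1, by omega⟩
  subst hQ
  refine ⟨?_, exists_sub_C_eq_prod_iff (by omega) hb hP hm hM⟩
  rintro P₀ a ha rfl
  exact exists_derivative_eq_prod ha
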